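/- arXiv:1401.1466 — 4 statements merged into one kernel-verified Lean document; each statement's English description precedes it below -/
import Mathlib

section
/- (Main theorem) For positive integers a, b, c with a ≤ b ≤ c, one has N(abc) ≥ min{N(a) + 1, N(b), N(c)}. -/
/-- A latin square of order `n`: an `n × n` array with entries from an `n`-element
symbol set such that every row and every column contains each symbol exactly once. -/
def IsLatinSquare {n : ℕ} (L : Fin n → Fin n → Fin n) : Prop :=
  (∀ i, Function.Bijective fun j => L i j) ∧ (∀ j, Function.Bijective fun i => L i j)

/-- Two latin squares of order `n` are orthogonal if the `n²` superimposed
ordered pairs of entries are all distinct. -/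
def AreOrthogonal {n : ℕ} (L M : Fin n → Fin n → Fin n) : Prop :=
  Function.Injective fun p : Fin n × Fin n => (L p.1 p.2, M p.1 p.2)

/-- There exist `r` mutually orthogonal latin squares (MOLS) of order `n`. -/
def HasMOLS (n r : ℕ) : Prop :=
  ∃ L : Fin r → Fin n → Fin n → Fin n,
    (∀ s, IsLatinSquare (L s)) ∧ ∀ s t : Fin r, s ≠ t → AreOrthogonal (L s) (L t)

/-- `molsNum n` is `N(n)`, the maximum size of a set of MOLS of order `n`. -/
noncomputable def molsNum (n : ℕ) : ℕ := sSup {r | HasMOLS n r}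

/-- Orthogonal array of strength two, with column set `J` and `n` symbols. -/
def IsOA (J : Type) (n : ℕ) : Prop :=
  ∃ F : J → Fin n × Fin n → Fin n, ∀ i j, i ≠ j → Function.Injective fun p => (F i p, F j p)

lemma isOA_of {J W : Type} [Fintype W] {X : J → Type} [∀ j, Fintype (X j)] {n : ℕ}
    (hW : Fintype.card W = n * n) (hX : ∀ j, Fintype.card (X j) = n)
    (F : ∀ j, W → X j)
    (hF : ∀ i j, i ≠ j → ∀ p q, F i p = F i q → F j p = F j q → p = q) : IsOA J n := by
  let e : Fin n × Fin n ≃ W := Fintype.equivOfCardEq (by simp [hW])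
  let d : ∀ j, X j ≃ Fin n := fun j => Fintype.equivOfCardEq (by simp [hX])
  refine ⟨fun j p => d j (F j (e p)), fun i j hij p q h => ?_⟩
  simp only [Prod.mk.injEq, EmbeddingLike.apply_eq_iff_eq] at h
  exact e.injective (hF i j hij _ _ h.1 h.2)

lemma IsOA.comp {J K : Type} {n : ℕ} (h : IsOA J n) (f : K → J) (hf : Function.Injective f) :
    IsOA K n := by
  obtain ⟨F, hF⟩ := h
  exact ⟨fun k => F (f k), fun i j hij => hF _ _ (hf.ne hij)⟩

lemma HasMOLS.isOA {n r : ℕ} (h : HasMOLS n r) : IsOA (Option (Option (Fin r))) n := by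
  obtain ⟨L, hL, hO⟩ := h
  refine ⟨fun j p => match j with
    | none => p.1
    | some none => p.2
    | some (some s) => L s p.1 p.2, ?_⟩
  rintro (_ | _ | s) (_ | _ | t) hij ⟨p1, p2⟩ ⟨q1, q2⟩ h <;>
    simp only [Prod.mk.injEq] at h ⊢ <;> obtain ⟨h1, h2⟩ := h <;> try (exact absurd rfl hij)
  · exact ⟨h1, h2⟩
  · subst h1; exact ⟨rfl, ((hL t).1 p1).1 h2⟩
  · exact ⟨h2, h1⟩
  · subst h1; exact ⟨((hL t).2 p2).1 h2, rfl⟩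
  · subst h2; exact ⟨rfl, ((hL s).1 p1).1 h1⟩
  · subst h2; exact ⟨((hL s).2 p2).1 h1, rfl⟩
  · have hst : s ≠ t := fun h => hij (by rw [h])
    have := @hO s t hst (p1, p2) (q1, q2) (by simp [h1, h2])
    simpa using this

lemma IsOA.hasMOLS {n r : ℕ} (h : IsOA (Option (Option (Fin r))) n) : HasMOLS n r := by
  obtain ⟨F, hF⟩ := h
  let e : Fin n × Fin n ≃ Fin n × Fin n :=
    Equiv.ofBijective _ (Finite.injective_iff_bijective.1 (hF none (some none) (by simp)))
  have e1 : ∀ p, F none (e.symm p) = p.1 := fun p => congrArg Prod.fst (e.apply_symm_apply p)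
  have e2 : ∀ p, F (some none) (e.symm p) = p.2 :=
    fun p => congrArg Prod.snd (e.apply_symm_apply p)
  refine ⟨fun s i j => F (some (some s)) (e.symm (i, j)), fun s => ⟨fun i => ?_, fun j => ?_⟩,
    fun s t hst => ?_⟩
  · refine Finite.injective_iff_bijective.1 fun x y hxy => ?_
    have := @hF none (some (some s)) (by simp) (e.symm (i, x)) (e.symm (i, y))
      (by simp only [e1]; simpa using hxy)
    simpa using this
  · refine Finite.injective_iff_bijective.1 fun x y hxy => ?_
    have := @hF (some none) (some (some s)) (by simp) (e.symm (x, j)) (e.symm (y, j))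
      (by simp only [e2]; simpa using hxy)
    simpa using this
  · intro p q hpq
    have := @hF (some (some s)) (some (some t)) (by simpa using hst) (e.symm p) (e.symm q) hpq
    simpa using this

lemma HasMOLS.le {n r : ℕ} (hn : 2 ≤ n) (h : HasMOLS n r) : r ≤ n := by
  obtain ⟨L, hL, hO⟩ := h
  let o : Fin n := ⟨0, by omega⟩
  let i : Fin n := ⟨1, by omega⟩
  have hoi : o ≠ i := by simp [o, i]
  choose f hf using fun s => ((hL s).1 o).2 (L s i o)
  have hinj : Function.Injective f := by
    intro s t hst
    by_contra hne
    have h1 := hf s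
    have h2 := hf t
    rw [← hst] at h2
    have := @hO s t hne (o, f s) (i, o) (by simpa using ⟨h1, h2⟩)
    exact hoi (congrArg Prod.fst this)
  simpa using Fintype.card_le_of_injective f hinj

lemma HasMOLS.mono {n r s : ℕ} (h : HasMOLS n r) (hs : s ≤ r) : HasMOLS n s := by
  obtain ⟨L, hL, hO⟩ := h
  exact ⟨fun i => L (Fin.castLE hs i), fun i => hL _,
    fun i j hij => hO _ _ ((Fin.castLE_injective hs).ne hij)⟩

lemma hasMOLS_zero (n : ℕ) : HasMOLS n 0 := ⟨fun i => i.elim0, fun i => i.elim0, fun i => i.elim0⟩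

lemma bddAbove_mols {n : ℕ} (hn : 2 ≤ n) : BddAbove {r | HasMOLS n r} :=
  ⟨n, fun _ h => HasMOLS.le hn h⟩

lemma hasMOLS_molsNum (n : ℕ) : HasMOLS n (molsNum n) := by
  by_cases h : BddAbove {r | HasMOLS n r}
  · exact Nat.sSup_mem ⟨0, hasMOLS_zero n⟩ h
  · have : molsNum n = 0 := Nat.sSup_of_not_bddAbove h
    rw [this]; exact hasMOLS_zero n

lemma molsNum_one : molsNum 1 = 0 := by
  refine Nat.sSup_of_not_bddAbove ?_
  rintro ⟨m, hm⟩
  have : HasMOLS 1 (m + 1) :=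
    ⟨fun _ _ _ => 0, fun _ => ⟨fun _ => ⟨fun _ _ _ => Subsingleton.elim _ _,
        fun y => ⟨0, Subsingleton.elim _ _⟩⟩, fun _ => ⟨fun _ _ _ => Subsingleton.elim _ _,
        fun y => ⟨0, Subsingleton.elim _ _⟩⟩⟩, fun _ _ _ _ _ _ => Subsingleton.elim _ _⟩
  have := hm this
  omega

/-- Class (of the new resolution) of a block of the triple product. -/
def cls {m a r s N : ℕ} {A T : Type} {Bt : Type} (e : Fin m × A → (Fin r × Fin s) ⊕ Fin N)
    (t : T → Bt) (q : (Fin m × Fin a) ⊕ Fin r) (x : A) (y : T) : (Fin r × T) ⊕ (Fin N × Bt) :=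
  match q with
  | .inr g => .inl (g, y)
  | .inl (i, _) => match e (i, x) with
    | .inl (g, _) => .inl (g, y)
    | .inr n => .inr (n, t y)

/-- Shift label in the third coordinate. -/
def lab {m a r s N b : ℕ} {A : Type} (e : Fin m × A → (Fin r × Fin s) ⊕ Fin N)
    (l : Fin a ⊕ Fin s → ZMod b) (q : (Fin m × Fin a) ⊕ Fin r) (x : A) (x' : Fin a) : ZMod b :=
  match q with
  | .inr _ => l (.inl x')
  | .inl (i, _) => match e (i, x) with
    | .inl (_, k) => l (.inr k)
    | .inr _ => 0

/-- Shift in the first coordinate. -/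
def shf {m a r : ℕ} (z : Fin a → ZMod a) (q : (Fin m × Fin a) ⊕ Fin r) : ZMod a :=
  match q with
  | .inr _ => 0
  | .inl (_, u) => z u

/-- The coordinate and the class determine the block (without the second coordinate). -/
lemma cls_lab_inj {m a r s N b : ℕ} {A T Bt G V : Type}
    (e : Fin m × A ≃ (Fin r × Fin s) ⊕ Fin N) (t : T → Bt) (l : Fin a ⊕ Fin s ≃ ZMod b)
    (z : Fin a ≃ ZMod a) (qf : G → (Fin m × Fin a) ⊕ Fin r) (Cj : G → V)
    (hC : ∀ g g', Cj g = Cj g' → qf g = qf g' → g = g')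
    (Aj : A → ZMod a) (A' : A → Fin a) (hA : ∀ x x', Aj x = Aj x' → A' x = A' x' → x = x')
    (Bj : T → ZMod b) (hB : ∀ y y', Bj y = Bj y' → t y = t y' → y = y')
    (x x' : A) (g g' : G) (y y' : T)
    (h1 : Aj x + shf z (qf g) = Aj x' + shf z (qf g')) (h2 : Cj g = Cj g')
    (h3 : Bj y + lab e l (qf g) x (A' x) = Bj y' + lab e l (qf g') x' (A' x'))
    (h4 : cls e t (qf g) x y = cls e t (qf g') x' y') : x = x' ∧ g = g' ∧ y = y' := by
  have key : x = x' → qf g = qf g' → y = y' → x = x' ∧ g = g' ∧ y = y' :=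
    fun hx hq hy => ⟨hx, hC _ _ h2 hq, hy⟩
  rcases hq : qf g with ⟨i, u⟩ | k <;> rcases hq' : qf g' with ⟨i', u'⟩ | k' <;>
    simp only [hq, hq', cls, lab, shf] at h1 h3 h4 key
  · rcases he : e (i, x) with ⟨w, v⟩ | w <;> rcases he' : e (i', x') with ⟨w', v'⟩ | w' <;>
      simp only [he, he', Sum.inl.injEq, Sum.inr.injEq, Prod.mk.injEq, reduceCtorEq] at h3 h4
    · obtain ⟨rfl, rfl⟩ := h4
      have := l.injective (add_left_cancel h3)
      simp only [Sum.inr.injEq] at this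
      subst this
      have := e.injective (he.trans he'.symm)
      simp only [Prod.mk.injEq] at this
      obtain ⟨rfl, rfl⟩ := this
      have := z.injective (add_left_cancel h1)
      subst this
      exact key rfl rfl rfl
    · obtain ⟨rfl, h4⟩ := h4
      have := e.injective (he.trans he'.symm)
      simp only [Prod.mk.injEq] at this
      obtain ⟨rfl, rfl⟩ := this
      have := z.injective (add_left_cancel h1)
      subst this
      exact key rfl rfl (hB _ _ (by simpa using h3) h4)
  · rcases he : e (i, x) with ⟨w, v⟩ | w <;>
      simp only [he, Sum.inl.injEq, Prod.mk.injEq, reduceCtorEq] at h3 h4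
    obtain ⟨rfl, rfl⟩ := h4
    have := l.injective (add_left_cancel h3)
    simp at this
  · rcases he' : e (i', x') with ⟨w', v'⟩ | w' <;>
      simp only [he', Sum.inl.injEq, Prod.mk.injEq, reduceCtorEq] at h3 h4
    obtain ⟨rfl, rfl⟩ := h4
    have := l.injective (add_left_cancel h3)
    simp at this
  · simp only [Sum.inl.injEq, Prod.mk.injEq] at h4
    obtain ⟨rfl, rfl⟩ := h4
    have := l.injective (add_left_cancel h3)
    simp only [Sum.inl.injEq] at this
    exact key (hA _ _ (by simpa using h1) this) rfl rfl

lemma triple_OA {J : Type} [Nontrivial J] {a b c : ℕ} (ha : 0 < a) (hab : a ≤ b) (hbc : b ≤ c)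
    (hA : IsOA J a) (hB : IsOA (Option J) b) (hC : IsOA (Option J) c) :
    IsOA (Option J) (a * b * c) := by
  classical
  obtain ⟨A, hA⟩ := hA
  obtain ⟨B, hB⟩ := hB
  obtain ⟨C, hC⟩ := hC
  have : NeZero a := ⟨by omega⟩
  have : NeZero b := ⟨by omega⟩
  obtain ⟨m, r, hr, hm⟩ : ∃ m r, r < a ∧ c = m * a + r :=
    ⟨c / a, c % a, Nat.mod_lt _ ha, by rw [mul_comm]; exact (Nat.div_add_mod c a).symm⟩
  obtain ⟨s, rfl⟩ := Nat.exists_eq_add_of_le hab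
  obtain ⟨N, hN⟩ : ∃ N, m * (a * a) = r * s + N := by
    apply Nat.exists_eq_add_of_le
    have h1 : r * (a + s) ≤ a * (m * a + r) :=
      Nat.mul_le_mul hr.le (by omega)
    nlinarith
  let z : Fin a ≃ ZMod a := Fintype.equivOfCardEq (by simp [ZMod.card])
  let zb : Fin (a + s) ≃ ZMod (a + s) := Fintype.equivOfCardEq (by simp [ZMod.card])
  let l : Fin a ⊕ Fin s ≃ ZMod (a + s) := Fintype.equivOfCardEq (by simp [ZMod.card])
  let e : Fin m × (Fin a × Fin a) ≃ (Fin r × Fin s) ⊕ Fin N :=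
    Fintype.equivOfCardEq (by simp [hN])
  let d : Fin c ≃ (Fin m × Fin a) ⊕ Fin r := Fintype.equivOfCardEq (by simp [hm])
  choose o ho using fun j : J => exists_ne j
  let qf : Fin c × Fin c → (Fin m × Fin a) ⊕ Fin r := fun g => d (C none g)
  let X : Option J → Type := fun j => match j with
    | none => (Fin r × (Fin (a + s) × Fin (a + s))) ⊕ (Fin N × Fin (a + s))
    | some _ => ZMod a × Fin c × ZMod (a + s)
  let : ∀ j, Fintype (X j) := fun j => match j with
    | none => inferInstanceAs
        (Fintype ((Fin r × (Fin (a + s) × Fin (a + s))) ⊕ (Fin N × Fin (a + s))))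
    | some _ => inferInstanceAs (Fintype (ZMod a × Fin c × ZMod (a + s)))
  let F : ∀ j, (Fin a × Fin a) × (Fin c × Fin c) × (Fin (a + s) × Fin (a + s)) → X j :=
    fun j w => match j with
    | none => cls e (B none) (qf w.2.1) w.1 w.2.2
    | some j => (z (A j w.1) + shf z (qf w.2.1), C (some j) w.2.1,
        zb (B (some j) w.2.2) + lab e l (qf w.2.1) w.1 (A (o j) w.1))
  have main : ∀ j w w', F (some j) w = F (some j) w' → F none w = F none w' → w = w' := by
    rintro j ⟨x, g, y⟩ ⟨x', g', y'⟩ h h4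
    obtain ⟨h1, h2⟩ := Prod.mk.inj h
    obtain ⟨h2, h3⟩ := Prod.mk.inj h2
    have := cls_lab_inj e (B none) l z qf (C (some j))
      (fun g g' h h' => @hC (some j) none (by simp) g g' (Prod.ext h (d.injective h')))
      (fun x => z (A j x)) (A (o j))
      (fun x x' h h' => @hA j (o j) (ho j).symm x x' (Prod.ext (z.injective h) h'))
      (fun y => zb (B (some j) y))
      (fun y y' h h' => @hB (some j) none (by simp) y y' (Prod.ext (zb.injective h) h'))
      x x' g g' y y' h1 h2 h3 h4
    obtain ⟨rfl, rfl, rfl⟩ := this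
    rfl
  refine isOA_of (X := X) ?_ ?_ F ?_
  · simp only [Fintype.card_prod, Fintype.card_fin]; ring
  · rintro (_ | j)
    · change Fintype.card
        ((Fin r × (Fin (a + s) × Fin (a + s))) ⊕ (Fin N × Fin (a + s))) = _
      simp only [Fintype.card_prod, Fintype.card_fin, Fintype.card_sum]
      rw [hm]
      have : (m * (a * a)) * (a + s) = (r * s + N) * (a + s) := by rw [hN]
      linarith
    · change Fintype.card (ZMod a × Fin c × ZMod (a + s)) = _
      simp only [Fintype.card_prod, Fintype.card_fin, ZMod.card]; ring
  · rintro (_ | i) (_ | j) hij w w' h h'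
    · exact absurd rfl hij
    · exact main j w w' h' h
    · exact main i w w' h h'
    · have hij' : i ≠ j := fun h => hij (by rw [h])
      obtain ⟨x, g, y⟩ := w
      obtain ⟨x', g', y'⟩ := w'
      obtain ⟨h1, h2⟩ := Prod.mk.inj h
      obtain ⟨h2, h3⟩ := Prod.mk.inj h2
      obtain ⟨k1, k2⟩ := Prod.mk.inj h'
      obtain ⟨k2, k3⟩ := Prod.mk.inj k2
      dsimp only at h1 h2 h3 k1 k2 k3
      have hg : g = g' := hC _ _ hij (Prod.ext h2 k2)
      subst hg
      have hx : x = x' := hA _ _ hij'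
        (Prod.ext (z.injective (add_right_cancel h1)) (z.injective (add_right_cancel k1)))
      subst hx
      have hy : y = y' := hB _ _ hij
        (Prod.ext (zb.injective (add_right_cancel h3)) (zb.injective (add_right_cancel k3)))
      subst hy
      rfl

theorem triple_product_bound : ∀ a b c : ℕ, 0 < a → 0 < b → 0 < c → a ≤ b → b ≤ c → min (molsNum a + 1) (min (molsNum b) (molsNum c)) ≤ molsNum (a * b * c) := by
  intro a b c ha hb hc hab hbc
  by_cases hc1 : c = 1
  · subst hc1
    rw [molsNum_one]; simp
  have hn : 2 ≤ a * b * c := by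
    have : 1 ≤ a * b := Nat.mul_pos ha hb
    nlinarith [Nat.mul_le_mul this (show 2 ≤ c by omega)]
  generalize hk : min (molsNum a + 1) (min (molsNum b) (molsNum c)) = k
  have hka : k ≤ molsNum a + 1 := by omega
  have hkb : k ≤ molsNum b := by omega
  have hkc : k ≤ molsNum c := by omega
  rcases Nat.eq_zero_or_pos k with rfl | hk0
  · exact Nat.zero_le _
  have : NeZero k := ⟨by omega⟩
  refine le_csSup (bddAbove_mols hn) (IsOA.hasMOLS ?_)
  have : Nontrivial (Option (Fin k)) := ⟨none, some 0, by simp⟩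
  refine triple_OA ha hab hbc ?_ ((hasMOLS_molsNum b).mono hkb).isOA
    ((hasMOLS_molsNum c).mono hkc).isOA
  obtain ⟨f⟩ : Nonempty (Option (Fin k) ↪ Option (Option (Fin (molsNum a)))) :=
    Function.Embedding.nonempty_of_card_le (by simpa using hka)
  exact (hasMOLS_molsNum a).isOA.comp f f.injective
end

section
/- N(1224) ≥ 8; that is, there exist 8 mutually orthogonal latin squares of order 1224 = 8 × 9 × 17. -/
open Function

/-- Transversal design with ten groups, all indexed by `X`; blocks indexed by `β`. -/
def IsTD {β X : Type} (B : β → Fin 10 → X) : Prop :=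
  ∀ i j, i ≠ j → ∀ x y, ∃! c, B c i = x ∧ B c j = y

/-- Incomplete transversal design with hole `U`. -/
def IsITD {β M U : Type} (B : β → Fin 10 → M ⊕ U) : Prop :=
  ∀ i j, i ≠ j → (∀ c u v, ¬ (B c i = Sum.inr u ∧ B c j = Sum.inr v)) ∧
    ∀ x y, (x.isLeft ∨ y.isLeft) → ∃! c, B c i = x ∧ B c j = y

/-- A transversal design on `X` exists. -/
def TD (X : Type) : Prop := ∃ (β : Type) (B : β → Fin 10 → X), IsTD B

/-- An incomplete transversal design on `M ⊕ U` with hole `U` exists. -/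
def ITD (M U : Type) : Prop := ∃ (β : Type) (B : β → Fin 10 → M ⊕ U), IsITD B

theorem TD.congr {X Y : Type} (e : X ≃ Y) (h : TD X) : TD Y := by
  obtain ⟨β, B, hB⟩ := h
  refine ⟨β, fun c i => e (B c i), fun i j hij x y => ?_⟩
  have := hB i j hij (e.symm x) (e.symm y)
  simpa only [Equiv.eq_symm_apply] using this

theorem ITD.congr {M U M' U' : Type} (e : M ≃ M') (f : U ≃ U') (h : ITD M U) : ITD M' U' := by
  obtain ⟨β, B, hB⟩ := h
  refine ⟨β, fun c i => (Equiv.sumCongr e f) (B c i), fun i j hij => ⟨?_, fun x y hxy => ?_⟩⟩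
  · rintro c u v ⟨h1, h2⟩
    rw [← Equiv.eq_symm_apply] at h1 h2
    exact (hB i j hij).1 c (f.symm u) (f.symm v) ⟨by simpa using h1, by simpa using h2⟩
  · have := (hB i j hij).2 ((Equiv.sumCongr e f).symm x) ((Equiv.sumCongr e f).symm y)
      (by cases x <;> cases y <;> simp_all)
    simpa only [Equiv.eq_symm_apply] using this

theorem TD.toITD {M U : Type} [IsEmpty U] (h : TD M) : ITD M U := by
  obtain ⟨β, B, hB⟩ := h
  refine ⟨β, fun c i => Sum.inl (B c i), fun i j hij => ⟨?_, fun x y hxy => ?_⟩⟩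
  · rintro c u; exact isEmptyElim u
  · rcases x with x | x
    · rcases y with y | y
      · simpa using hB i j hij x y
      · exact isEmptyElim y
    · exact isEmptyElim x

theorem mols_of_td {n : ℕ} (h : TD (Fin n)) : HasMOLS n 8 := by
  obtain ⟨β, B, hB⟩ := h
  choose c hc hu using fun x y => hB 0 1 (by decide) x y
  have hc' : ∀ b, c (B b 0) (B b 1) = b := fun b => ((hu _ _ b) ⟨rfl, rfl⟩).symm
  have key : ∀ i j, i ≠ j → ∀ b b', B b i = B b' i → B b j = B b' j → b = b' :=
    fun i j hij b b' h1 h2 => (hB i j hij _ _).unique ⟨h1, h2⟩ ⟨rfl, rfl⟩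
  have cinj : ∀ x y x' y', c x y = c x' y' → x = x' ∧ y = y' := by
    intro x y x' y' h
    refine ⟨?_, ?_⟩
    · rw [← (hc x y).1, h, (hc x' y').1]
    · rw [← (hc x y).2, h, (hc x' y').2]
  let r : Fin 8 → Fin 10 := fun s => ⟨s.val + 2, by omega⟩
  have r0 : ∀ s, (0 : Fin 10) ≠ r s := by decide
  have r1 : ∀ s, (1 : Fin 10) ≠ r s := by decide
  have rr : ∀ s t, s ≠ t → r s ≠ r t := by decide
  refine ⟨fun s x y => B (c x y) (r s), fun s => ⟨fun x => ?_, fun y => ?_⟩, fun s t hst => ?_⟩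
  · apply Finite.injective_iff_bijective.1
    intro y y' h
    refine (cinj x y x y' (key 0 (r s) (r0 s) _ _ ?_ h)).2
    rw [(hc _ _).1, (hc _ _).1]
  · apply Finite.injective_iff_bijective.1
    intro x x' h
    refine (cinj x y x' y (key 1 (r s) (r1 s) _ _ ?_ h)).1
    rw [(hc _ _).2, (hc _ _).2]
  · rintro ⟨x, y⟩ ⟨x', y'⟩ h
    simp only [Prod.mk.injEq] at h
    obtain ⟨h1, h2⟩ := cinj _ _ _ _ (key (r s) (r t) (rr s t hst) _ _ h.1 h.2)
    simp [h1, h2]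

/-- Difference matrix gives a transversal design. -/
theorem td_of_dm {G C : Type} [AddCommGroup G] (e : C ≃ G) (D : Fin 9 → C → G)
    (hD : ∀ i j, i ≠ j → Bijective fun c => D i c - D j c) : TD G := by
  let B : C × G → Fin 10 → G := fun p => Fin.snoc (α := fun _ => G) (fun i => D i p.1 + p.2) (e p.1)
  have Bc : ∀ p (i : Fin 9), B p i.castSucc = D i p.1 + p.2 := fun p i => by simp [B]
  have Bl : ∀ p, B p (Fin.last 9) = e p.1 := fun p => Fin.snoc_last _ _
  refine ⟨C × G, B, fun i j => ?_⟩
  refine Fin.lastCases ?_ (fun i => ?_) i <;> refine Fin.lastCases ?_ (fun j => ?_) j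
  · intro h; exact absurd rfl h
  · intro _ x y
    refine ⟨(e.symm x, y - D j (e.symm x)), ?_, ?_⟩
    · simp [Bc, Bl, -Fin.reduceLast]
    · rintro ⟨c, g⟩ ⟨h1, h2⟩
      rw [Bl] at h1; rw [Bc] at h2
      subst h1; subst h2; simp
  · intro _ x y
    refine ⟨(e.symm y, x - D i (e.symm y)), ?_, ?_⟩
    · simp [Bc, Bl, -Fin.reduceLast]
    · rintro ⟨c, g⟩ ⟨h2, h1⟩
      rw [Bl] at h1; rw [Bc] at h2
      subst h1; subst h2; simp
  · intro hij x y
    have hij' : i ≠ j := fun h => hij (by rw [h])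
    obtain ⟨c, hc⟩ := (hD i j hij').2 (x - y)
    simp only at hc
    refine ⟨(c, x - D i c), ⟨by simp [Bc], ?_⟩, ?_⟩
    · rw [Bc]
      have : D i c = x - y + D j c := by rw [← hc]; abel
      simp only [this]; abel
    · rintro ⟨c', g⟩ ⟨h1, h2⟩
      rw [Bc] at h1 h2
      simp only at h1 h2
      have : c' = c := by
        apply (hD i j hij').1
        simp only [hc, ← h1, ← h2]; abel
      subst this; subst h1; simp

theorem td_field {F : Type} [Field F] (e : Fin 9 ≃ F) : TD F := by
  let B : F × F → Fin 10 → F := fun p => Fin.snoc (α := fun _ => F) (fun i => p.1 + e i * p.2) p.2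
  have Bc : ∀ p (i : Fin 9), B p i.castSucc = p.1 + e i * p.2 := fun p i => by simp [B]
  have Bl : ∀ p, B p (Fin.last 9) = p.2 := fun p => Fin.snoc_last _ _
  refine ⟨F × F, B, fun i j => ?_⟩
  refine Fin.lastCases ?_ (fun i => ?_) i <;> refine Fin.lastCases ?_ (fun j => ?_) j
  · intro h; exact absurd rfl h
  · intro _ x y
    refine ⟨(y - e j * x, x), by simp [Bc, Bl, -Fin.reduceLast], ?_⟩
    rintro ⟨c, g⟩ ⟨h1, h2⟩
    rw [Bl] at h1; rw [Bc] at h2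
    subst h1; subst h2; simp
  · intro _ x y
    refine ⟨(x - e i * y, y), by simp [Bc, Bl, -Fin.reduceLast], ?_⟩
    rintro ⟨c, g⟩ ⟨h2, h1⟩
    rw [Bl] at h1; rw [Bc] at h2
    subst h1; subst h2; simp
  · intro hij x y
    have hne : e i - e j ≠ 0 := fun h => hij (by rw [e.injective (sub_eq_zero.1 h)])
    refine ⟨(x - e i * ((x - y) / (e i - e j)), (x - y) / (e i - e j)), ?_, ?_⟩
    · simp only [Bc]
      refine ⟨by ring, ?_⟩
      field_simp; ring
    · rintro ⟨c, g⟩ ⟨h1, h2⟩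
      rw [Bc] at h1 h2
      simp only at h1 h2
      have : (x - y) / (e i - e j) = g := by
        rw [← h1, ← h2]; field_simp; ring
      rw [this, ← h1]; simp

theorem slope_pair {F : Type} [Field F] (α : Fin 10 → F) (ha : Injective α) (i j : Fin 10) (hij : i ≠ j)
    (x y : F) : ∃! p : F × F, p.1 + α i * p.2 = x ∧ p.1 + α j * p.2 = y := by
  have hne : α i - α j ≠ 0 := fun h => hij (ha (sub_eq_zero.1 h))
  refine ⟨(x - α i * ((x - y) / (α i - α j)), (x - y) / (α i - α j)), ?_, ?_⟩
  · refine ⟨by ring, ?_⟩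
    simp only
    field_simp; ring
  · rintro ⟨c, g⟩ ⟨h1, h2⟩
    simp only at h1 h2
    have : (x - y) / (α i - α j) = g := by
      rw [← h1, ← h2]; field_simp; ring
    rw [this, ← h1]; simp

open Classical in
theorem itd_prod {F V : Type} [Field F] (α : Fin 10 → F) (ha : Injective α) (hV : TD V) :
    ITD ({x : F // x ≠ 0} × V) V := by
  obtain ⟨β, B, hB⟩ := hV
  let s : F × V → ({x : F // x ≠ 0} × V) ⊕ V :=
    fun p => if h : p.1 = 0 then Sum.inr p.2 else Sum.inl (⟨p.1, h⟩, p.2)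
  let t : ({x : F // x ≠ 0} × V) ⊕ V → F × V := Sum.elim (fun p => (p.1.1, p.2)) (fun v => (0, v))
  have ts : ∀ p, t (s p) = p := by
    intro p; by_cases h : p.1 = 0
    · simp [s, t, h, Prod.ext_iff]
    · simp [s, t, h]
  have st : ∀ q, s (t q) = q := by
    rintro (⟨⟨x, hx⟩, v⟩ | v)
    · simp [s, t, hx]
    · simp [s, t]
  have sinj : ∀ p q, s p = q ↔ p = t q := fun p q =>
    ⟨fun h => by rw [← h, ts], fun h => by rw [h, st]⟩
  refine ⟨{p : F × F // p ≠ 0} × β, fun c i => s (c.1.1.1 + α i * c.1.1.2, B c.2 i),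
    fun i j hij => ⟨?_, fun x y hxy => ?_⟩⟩
  · rintro ⟨⟨p, hp⟩, b⟩ u v ⟨h1, h2⟩
    simp only [sinj, t, Sum.elim_inr, Prod.mk.injEq] at h1 h2
    exact hp ((slope_pair α ha i j hij 0 0).unique ⟨h1.1, h2.1⟩ (by simp))
  · simp only [sinj]
    generalize hx : t x = x'
    generalize hy : t y = y'
    have hne : x'.1 ≠ 0 ∨ y'.1 ≠ 0 := by
      rcases hxy with h | h
      · left
        rcases x with x | x
        · rw [← hx]; exact x.1.2
        · simp at h
      · right
        rcases y with x | x
        · rw [← hy]; exact x.1.2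
        · simp at h
    obtain ⟨p, hp, hpu⟩ := slope_pair α ha i j hij x'.1 y'.1
    obtain ⟨b, hb, hbu⟩ := hB i j hij x'.2 y'.2
    have hp0 : p ≠ 0 := by
      rintro rfl
      simp only [Prod.fst_zero, Prod.snd_zero, mul_zero, add_zero] at hp
      rcases hne with h | h
      · exact h hp.1.symm
      · exact h hp.2.symm
    refine ⟨(⟨p, hp0⟩, b), ⟨Prod.ext hp.1 hb.1, Prod.ext hp.2 hb.2⟩, ?_⟩
    rintro ⟨⟨q, hq⟩, b'⟩ ⟨h1, h2⟩
    have e1 := hpu q ⟨congrArg Prod.fst h1, congrArg Prod.fst h2⟩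
    have e2 := hbu b' ⟨congrArg Prod.snd h1, congrArg Prod.snd h2⟩
    subst e1; subst e2; rfl

theorem master {F M : Type} {U : F → Type} [Field F] (α : Fin 10 → F) (ha : Injective α)
    (hI : ∀ b, ITD M (U b)) (hW : TD (Σ b, U b)) : TD ((F × M) ⊕ (Σ b, U b)) := by
  choose β B hB using hI
  obtain ⟨γ, C, hC⟩ := hW
  let E : ((Σ b : F, F × β b) ⊕ γ) → Fin 10 → (F × M) ⊕ (Σ b, U b) := fun c i =>
    Sum.elim (fun q => Sum.elim (fun m => Sum.inl (q.2.1 + α i * q.1, m))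
      (fun u => Sum.inr ⟨q.1, u⟩) (B q.1 q.2.2 i)) (fun g => Sum.inr (C g i)) c
  have El : ∀ b a c i t m, E (Sum.inl ⟨b, a, c⟩) i = Sum.inl (t, m) ↔
      a + α i * b = t ∧ B b c i = Sum.inl m := by
    intro b a c i t m
    rcases h : B b c i with x | x <;> simp [E, h]
  have Er : ∀ b a c i b' u, E (Sum.inl ⟨b, a, c⟩) i = Sum.inr ⟨b', u⟩ ↔
      ∃ h : b = b', B b c i = Sum.inr (h ▸ u) := by
    intro b a c i b' u
    rcases h : B b c i with x | x
    · simp [E, h]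
    · simp only [E, h, Sum.elim_inl, Sum.elim_inr, Sum.inr.injEq]
      constructor
      · intro h; cases h; exact ⟨rfl, rfl⟩
      · rintro ⟨rfl, h⟩; simp only at h; rw [h]
  have Gl : ∀ g i q, E (Sum.inr g) i ≠ Sum.inl q := by intro g i q; simp [E]
  have Gr : ∀ g i q, E (Sum.inr g) i = Sum.inr q ↔ C g i = q := by intro g i q; simp [E]
  refine ⟨_, E, fun i j hij x y => ?_⟩
  rcases x with ⟨t, m⟩ | ⟨b, u⟩ <;> rcases y with ⟨t', m'⟩ | ⟨b', u'⟩
  · obtain ⟨p, hp, hpu⟩ := slope_pair α ha i j hij t t'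
    obtain ⟨c, hc, hcu⟩ := (hB p.2 i j hij).2 (Sum.inl m) (Sum.inl m') (by simp)
    refine ⟨Sum.inl ⟨p.2, p.1, c⟩, ⟨(El _ _ _ _ _ _).2 ⟨hp.1, hc.1⟩, (El _ _ _ _ _ _).2 ⟨hp.2, hc.2⟩⟩, ?_⟩
    rintro (⟨b, a, c'⟩ | g) ⟨h1, h2⟩
    · rw [El] at h1 h2
      have e1 := hpu (a, b) ⟨h1.1, h2.1⟩
      subst e1
      have e2 := hcu c' ⟨h1.2, h2.2⟩
      subst e2; rfl
    · exact absurd h1 (Gl _ _ _)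
  · obtain ⟨c, hc, hcu⟩ := (hB b' i j hij).2 (Sum.inl m) (Sum.inr u') (by simp)
    refine ⟨Sum.inl ⟨b', t - α i * b', c⟩, ⟨(El _ _ _ _ _ _).2 ⟨by ring, hc.1⟩,
      (Er _ _ _ _ _ _).2 ⟨rfl, hc.2⟩⟩, ?_⟩
    rintro (⟨b, a, c'⟩ | g) ⟨h1, h2⟩
    · rw [El] at h1; rw [Er] at h2
      obtain ⟨rfl, h2⟩ := h2
      have e2 := hcu c' ⟨h1.2, h2⟩
      subst e2; rw [← h1.1]; simp
    · exact absurd h1 (Gl _ _ _)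
  · obtain ⟨c, hc, hcu⟩ := (hB b i j hij).2 (Sum.inr u) (Sum.inl m') (by simp)
    refine ⟨Sum.inl ⟨b, t' - α j * b, c⟩, ⟨(Er _ _ _ _ _ _).2 ⟨rfl, hc.1⟩,
      (El _ _ _ _ _ _).2 ⟨by ring, hc.2⟩⟩, ?_⟩
    rintro (⟨b, a, c'⟩ | g) ⟨h1, h2⟩
    · rw [El] at h2; rw [Er] at h1
      obtain ⟨rfl, h1⟩ := h1
      have e2 := hcu c' ⟨h1, h2.2⟩
      subst e2; rw [← h2.1]; simp
    · exact absurd h2 (Gl _ _ _)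
  · obtain ⟨g, hg, hgu⟩ := hC i j hij ⟨b, u⟩ ⟨b', u'⟩
    refine ⟨Sum.inr g, ⟨(Gr _ _ _).2 hg.1, (Gr _ _ _).2 hg.2⟩, ?_⟩
    rintro (⟨b, a, c'⟩ | g') ⟨h1, h2⟩
    · rw [Er] at h1 h2
      obtain ⟨rfl, h1⟩ := h1
      obtain ⟨rfl, h2⟩ := h2
      exact absurd ⟨h1, h2⟩ ((hB b i j hij).1 c' _ _)
    · rw [Gr] at h1 h2
      rw [hgu g' ⟨h1, h2⟩]

/-- Bit mask of a list of numbers. -/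
def mask : List ℕ → ℕ
  | [] => 0
  | x :: xs => 2 ^ x ||| mask xs

theorem mem_of_mask (l : List ℕ) (k : ℕ) (h : (mask l).testBit k = true) : k ∈ l := by
  induction l with
  | nil => simp [mask] at h
  | cons x xs ih =>
    simp only [mask, Nat.testBit_or, Nat.testBit_two_pow, Bool.or_eq_true, decide_eq_true_eq] at h
    rcases h with h | h
    · simp [h]
    · simp [ih h]

theorem td_of_cols {G : Type} [AddCommGroup G] [Fintype G] (n : ℕ) (hn : Fintype.card G = n)
    (dec : ℕ → G) (code : G → ℕ) (hcode : Injective code) (hlt : ∀ g, code g < n)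
    (cols : List (List ℕ)) (hlen : cols.length = n)
    (hm : ∀ i j : Fin 9, i ≠ j →
      mask (cols.map fun c => code (dec (c.getD i 0) - dec (c.getD j 0))) = 2 ^ n - 1) : TD G := by
  have hcard : Fintype.card (Fin cols.length) = Fintype.card G := by simp [hlen, hn]
  refine td_of_dm (Fintype.equivOfCardEq hcard) (fun i c => dec (cols[c].getD i 0)) fun i j hij => ?_
  refine (Fintype.bijective_iff_surjective_and_card _).2 ⟨fun g => ?_, hcard⟩
  have h := mem_of_mask _ (code g) (by rw [hm i j hij, Nat.testBit_two_pow_sub_one]; simpa using hlt g)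
  obtain ⟨c, hc, hcg⟩ := List.mem_map.1 h
  obtain ⟨k, hk, rfl⟩ := List.mem_iff_getElem.1 hc
  exact ⟨⟨k, hk⟩, hcode hcg⟩

def colsA : List (List ℕ) := [
  [0, 21, 9, 85, 88, 85, 35, 38, 53], [0, 22, 11, 88, 83, 87, 32, 42, 49], [0, 23, 10, 82, 84, 83, 29, 40, 45],
  [0, 24, 15, 94, 91, 91, 53, 32, 41], [0, 25, 17, 97, 95, 93, 50, 27, 37], [0, 26, 16, 91, 96, 98, 47, 34, 42],
  [0, 18, 12, 103, 103, 106, 44, 53, 29], [0, 19, 14, 106, 107, 99, 41, 48, 34], [0, 20, 13, 100, 99, 104, 38, 46, 30],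
  [85, 88, 85, 35, 38, 53, 0, 21, 9], [85, 89, 84, 29, 39, 46, 6, 19, 17], [85, 87, 86, 32, 43, 48, 3, 26, 13],
  [85, 82, 82, 44, 50, 32, 18, 15, 6], [85, 83, 81, 38, 51, 34, 24, 13, 5], [85, 81, 83, 41, 46, 27, 21, 11, 1],
  [85, 85, 88, 53, 35, 38, 9, 0, 21], [85, 86, 87, 47, 27, 40, 15, 7, 20], [85, 84, 89, 50, 31, 42, 12, 5, 25],
  [35, 38, 53, 0, 21, 9, 85, 88, 85], [35, 36, 52, 3, 25, 14, 82, 86, 81], [35, 37, 51, 6, 20, 16, 88, 81, 89],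
  [35, 41, 50, 9, 6, 24, 103, 100, 100], [35, 39, 49, 12, 1, 20, 100, 107, 105], [35, 40, 48, 15, 5, 22, 106, 102, 104],
  [35, 44, 47, 18, 9, 3, 94, 94, 97], [35, 42, 46, 21, 13, 8, 91, 92, 93], [35, 43, 45, 24, 17, 1, 97, 96, 92],
  [0, 84, 50, 12, 98, 33, 21, 106, 43], [0, 85, 49, 15, 90, 29, 18, 104, 39], [0, 86, 48, 9, 94, 31, 24, 99, 38],
  [0, 87, 47, 21, 101, 39, 12, 91, 31], [0, 88, 46, 24, 102, 44, 9, 98, 27], [0, 89, 45, 18, 106, 37, 15, 93, 35],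
  [0, 81, 53, 3, 86, 45, 3, 85, 46], [0, 82, 52, 6, 87, 50, 0, 83, 51], [0, 83, 51, 0, 82, 52, 6, 87, 50],
  [84, 50, 0, 98, 33, 12, 106, 43, 21], [84, 48, 2, 92, 28, 17, 103, 41, 20], [84, 49, 1, 95, 32, 10, 100, 36, 25],
  [84, 53, 6, 107, 36, 18, 97, 28, 9], [84, 51, 8, 101, 40, 23, 94, 35, 17], [84, 52, 7, 104, 44, 25, 91, 30, 13],
  [84, 47, 3, 89, 48, 6, 88, 49, 6], [84, 45, 5, 83, 52, 2, 85, 47, 5], [84, 46, 4, 86, 47, 4, 82, 51, 1],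
  [50, 0, 84, 33, 12, 98, 43, 21, 106], [50, 1, 86, 27, 16, 91, 40, 19, 102], [50, 2, 85, 30, 11, 93, 37, 26, 101],
  [50, 3, 81, 42, 24, 104, 34, 15, 94], [50, 4, 83, 36, 19, 106, 31, 13, 90], [50, 5, 82, 39, 23, 99, 28, 11, 98],
  [50, 6, 87, 51, 0, 83, 52, 0, 82], [50, 7, 89, 45, 4, 85, 49, 7, 87], [50, 8, 88, 48, 8, 87, 46, 5, 86],
  [0, 58, 41, 33, 25, 77, 78, 31, 26], [0, 59, 40, 27, 20, 79, 75, 29, 22], [0, 57, 39, 30, 21, 72, 72, 33, 18],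
  [0, 61, 38, 42, 1, 56, 69, 52, 14], [0, 62, 37, 36, 5, 58, 66, 50, 10], [0, 60, 36, 39, 6, 60, 63, 45, 15],
  [0, 55, 44, 51, 13, 71, 60, 37, 2], [0, 56, 43, 45, 17, 64, 57, 44, 7], [0, 54, 42, 48, 9, 66, 54, 39, 3],
  [58, 41, 0, 25, 77, 33, 31, 26, 78], [58, 39, 2, 19, 78, 29, 28, 21, 77], [58, 40, 1, 22, 73, 31, 34, 19, 73],
  [58, 44, 6, 7, 62, 39, 49, 11, 66], [58, 42, 8, 1, 54, 44, 46, 15, 65], [58, 43, 7, 4, 58, 37, 52, 13, 70],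
  [58, 38, 3, 16, 65, 45, 40, 5, 54], [58, 36, 5, 10, 66, 50, 37, 0, 62], [58, 37, 4, 13, 70, 52, 43, 7, 58],
  [41, 0, 58, 77, 33, 25, 26, 78, 31], [41, 1, 57, 80, 28, 18, 23, 76, 27], [41, 2, 59, 74, 32, 23, 20, 74, 35],
  [41, 3, 55, 59, 36, 4, 17, 63, 46], [41, 4, 54, 62, 40, 6, 14, 70, 51], [41, 5, 56, 56, 44, 2, 11, 68, 50],
  [41, 6, 61, 68, 48, 10, 8, 57, 43], [41, 7, 60, 71, 52, 12, 5, 55, 39], [41, 8, 62, 65, 47, 17, 2, 62, 38],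
  [0, 31, 92, 44, 105, 10, 91, 8, 33], [0, 32, 91, 38, 100, 12, 97, 3, 32], [0, 30, 90, 41, 104, 17, 94, 1, 28],
  [0, 34, 98, 53, 81, 25, 82, 20, 48], [0, 35, 97, 47, 85, 18, 88, 24, 47], [0, 33, 96, 50, 89, 23, 85, 22, 52],
  [0, 28, 95, 35, 93, 4, 100, 14, 36], [0, 29, 94, 29, 97, 6, 106, 9, 44], [0, 27, 93, 32, 92, 2, 103, 16, 40],
  [31, 92, 0, 105, 10, 44, 8, 33, 91], [31, 90, 2, 99, 14, 37, 5, 31, 96], [31, 91, 1, 102, 15, 39, 2, 29, 95],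
  [31, 95, 6, 87, 22, 50, 26, 45, 88], [31, 93, 8, 81, 26, 52, 23, 52, 84], [31, 94, 7, 84, 18, 45, 20, 50, 83],
  [31, 98, 3, 96, 7, 29, 17, 39, 103], [31, 96, 5, 90, 2, 31, 14, 37, 99], [31, 97, 4, 93, 3, 33, 11, 44, 107],
  [92, 0, 31, 10, 44, 105, 33, 91, 8], [92, 1, 30, 13, 36, 101, 30, 98, 4], [92, 2, 32, 16, 40, 103, 27, 93, 0],
  [92, 3, 28, 19, 47, 84, 51, 85, 23], [92, 4, 27, 22, 48, 89, 48, 83, 19], [92, 5, 29, 25, 52, 82, 45, 87, 24],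
  [92, 6, 34, 1, 32, 90, 42, 106, 11], [92, 7, 33, 4, 33, 95, 39, 104, 16], [92, 8, 35, 7, 28, 97, 36, 99, 12]]

def colsB : List (List ℕ) := [
  [0, 2, 7, 34, 34, 31, 18, 19, 26], [0, 5, 4, 33, 27, 27, 19, 23, 21], [0, 8, 1, 35, 32, 35, 20, 24, 19],
  [34, 34, 31, 18, 19, 26, 0, 2, 7], [34, 28, 28, 20, 21, 22, 1, 3, 5], [34, 31, 34, 19, 26, 18, 2, 7, 0],
  [18, 19, 26, 0, 2, 7, 34, 34, 31], [18, 22, 23, 2, 4, 3, 35, 29, 29], [18, 25, 20, 1, 6, 2, 33, 30, 33],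
  [0, 23, 30, 2, 25, 29, 0, 20, 33], [0, 26, 27, 1, 18, 34, 1, 21, 31], [0, 20, 33, 0, 23, 30, 2, 25, 29],
  [23, 30, 0, 25, 29, 2, 20, 33, 0], [23, 33, 6, 24, 31, 7, 18, 28, 7], [23, 27, 3, 26, 33, 3, 19, 32, 5],
  [30, 0, 23, 29, 2, 25, 33, 0, 20], [30, 3, 20, 28, 4, 21, 34, 4, 24], [30, 6, 26, 27, 6, 20, 35, 8, 22],
  [0, 28, 24, 26, 5, 33, 34, 18, 0], [0, 31, 21, 25, 7, 32, 35, 22, 7], [0, 34, 18, 24, 0, 28, 33, 26, 5],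
  [28, 24, 0, 5, 33, 26, 18, 0, 34], [28, 18, 6, 4, 29, 22, 19, 4, 32], [28, 21, 3, 3, 31, 18, 20, 8, 27],
  [24, 0, 28, 33, 26, 5, 0, 34, 18], [24, 3, 34, 35, 19, 1, 1, 29, 25], [24, 6, 31, 34, 21, 6, 2, 30, 23],
  [0, 35, 23, 27, 21, 7, 26, 6, 35], [0, 29, 20, 29, 26, 3, 24, 1, 30], [0, 32, 26, 28, 19, 2, 25, 5, 28],
  [35, 23, 0, 21, 7, 27, 6, 35, 26], [35, 26, 6, 23, 0, 35, 7, 27, 21], [35, 20, 3, 22, 5, 31, 8, 31, 19],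
  [23, 0, 35, 7, 27, 21, 35, 26, 6], [23, 3, 32, 6, 32, 20, 33, 18, 4], [23, 6, 29, 8, 34, 25, 34, 22, 2]]

/-- The group of order 108. -/
abbrev GA := Fin 2 × Fin 2 × Fin 3 × Fin 3 × Fin 3

/-- The group of order 36. -/
abbrev GB := Fin 2 × Fin 2 × Fin 3 × Fin 3

def decA (n : ℕ) : GA :=
  (Fin.ofNat 2 (n / 54), Fin.ofNat 2 (n / 27), Fin.ofNat 3 (n / 9), Fin.ofNat 3 (n / 3), Fin.ofNat 3 n)

def codeA (g : GA) : ℕ :=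
  g.1.val * 54 + g.2.1.val * 27 + g.2.2.1.val * 9 + g.2.2.2.1.val * 3 + g.2.2.2.2.val

def decB (n : ℕ) : GB :=
  (Fin.ofNat 2 (n / 18), Fin.ofNat 2 (n / 9), Fin.ofNat 3 (n / 3), Fin.ofNat 3 n)

def codeB (g : GB) : ℕ :=
  g.1.val * 18 + g.2.1.val * 9 + g.2.2.1.val * 3 + g.2.2.2.val

theorem td_GA : TD GA := by
  refine td_of_cols 108 (by decide +kernel) decA codeA ?_ ?_ colsA (by decide +kernel) (by decide +kernel)
  · have : LeftInverse decA codeA := by unfold LeftInverse; decide +kernel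
    exact this.injective
  · decide +kernel

theorem td_GB : TD GB := by
  refine td_of_cols 36 (by decide +kernel) decB codeB ?_ ?_ colsB (by decide +kernel) (by decide +kernel)
  · have : LeftInverse decB codeB := by unfold LeftInverse; decide +kernel
    exact this.injective
  · decide +kernel

theorem td9 : TD (Fin 9) := by
  have : Fact (Nat.Prime 3) := ⟨by norm_num⟩
  have hc : Nat.card (GaloisField 3 2) = 9 := by rw [GaloisField.card 3 2 (by norm_num)]; norm_num
  have : Finite (GaloisField 3 2) := Nat.finite_of_card_ne_zero (by omega)
  have e : Fin 9 ≃ GaloisField 3 2 := (Finite.equivFinOfCardEq hc).symm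
  exact (td_field e).congr e.symm

theorem inj13 : Injective fun i : Fin 10 => (i.val : ZMod 13) := by decide +kernel

theorem inj11 : Injective fun i : Fin 10 => (i.val : ZMod 11) := by decide +kernel

theorem card108 : Fintype.card ({x : ZMod 13 // x ≠ 0} × Fin 9) = Fintype.card GA := by
  decide +kernel

theorem itd117 : ITD GA (Fin 9) := by
  have : Fact (Nat.Prime 13) := ⟨by norm_num⟩
  have h := itd_prod (F := ZMod 13) _ inj13 td9
  refine h.congr (Fintype.equivOfCardEq card108) (Equiv.refl _)

theorem td1224 : TD (Fin 1224) := by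
  have : Fact (Nat.Prime 11) := ⟨by norm_num⟩
  let U : ZMod 11 → Type := fun b => Fin (if b.val < 4 then 9 else 0)
  have hU : Fintype.card (Σ b, U b) = 36 := by
    simp only [U, Fintype.card_sigma, Fintype.card_fin]
    decide +kernel
  have hI : ∀ b, ITD GA (U b) := by
    intro b
    by_cases h : b.val < 4
    · have : U b = Fin 9 := by simp [U, h]
      rw [this]; exact itd117
    · have : U b = Fin 0 := by simp [U, h]
      rw [this]; exact td_GA.toITD
  have hW : TD (Σ b, U b) := td_GB.congr (Fintype.equivOfCardEq (by rw [hU]; decide +kernel))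
  have := master (F := ZMod 11) _ inj11 hI hW
  refine this.congr (Fintype.equivOfCardEq ?_)
  rw [Fintype.card_sum, hU, Fintype.card_prod, ZMod.card, Fintype.card_fin]
  simp

theorem bdd (n : ℕ) (hn : 2 ≤ n) : BddAbove {r | HasMOLS n r} := by
  refine ⟨Fintype.card (Fin n → Fin n → Fin n), ?_⟩
  rintro r ⟨L, hL, hO⟩
  have hinj : Injective L := by
    intro s t hst
    by_contra hne
    have h := hO s t hne
    rw [hst] at h
    obtain ⟨y, hy⟩ := ((hL t).1 ⟨1, by omega⟩).2 (L t ⟨0, by omega⟩ ⟨0, by omega⟩)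
    have h2 := @h (⟨1, by omega⟩, y) (⟨0, by omega⟩, ⟨0, by omega⟩) (by simpa using hy)
    simp at h2
  simpa using Fintype.card_le_of_injective L hinj

theorem molsNum_1224 : 8 ≤ molsNum (8 * 9 * 17) := by
  exact le_csSup (bdd _ (by norm_num)) (mols_of_td td1224)
end

section
/- N(9424) ≥ 16; that is, there exist 16 mutually orthogonal latin squares of order 9424 = 16 × 19 × 31. -/
namespace TripleProduct

/-- From an orthogonal array with 18 columns to 16 MOLS. -/
lemma hasMOLS_of_array {n : ℕ} {X : Type} [Fintype X] (hX : Fintype.card X = n * n)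
    (c : Option (Fin 17) → X → Fin n)
    (hc : ∀ g h, g ≠ h → Function.Injective fun x => (c g x, c h x)) : HasMOLS n 16 := by
  have hb : ∀ g h, g ≠ h → Function.Bijective fun x => (c g x, c h x) := fun g h hgh =>
    (Fintype.bijective_iff_injective_and_card _).2 ⟨hc g h hgh, by simp [hX]⟩
  let e : X ≃ Fin n × Fin n := Equiv.ofBijective _ (hb none (some 0) (by simp))
  have he0 : ∀ p, c none (e.symm p) = p.1 := fun p =>
    congrArg Prod.fst (e.apply_symm_apply p)
  have he1 : ∀ p, c (some 0) (e.symm p) = p.2 := fun p =>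
    congrArg Prod.snd (e.apply_symm_apply p)
  refine ⟨fun s i j => c (some s.succ) (e.symm (i, j)), ?_, ?_⟩
  · intro s
    refine ⟨fun i => ?_, fun j => ?_⟩
    · refine Finite.injective_iff_bijective.1 ?_
      intro j j' hjj
      have := hc none (some s.succ) (by simp) (a₁ := e.symm (i, j)) (a₂ := e.symm (i, j'))
        (Prod.ext (by simp [he0]) hjj)
      simpa using this
    · refine Finite.injective_iff_bijective.1 ?_
      intro i i' hii
      have := hc (some 0) (some s.succ) (by simpa using (Fin.succ_ne_zero s).symm)
        (a₁ := e.symm (i, j)) (a₂ := e.symm (i', j))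
        (Prod.ext (by simp [he1]) hii)
      simpa using this
  · intro s t hst p p' hpp
    have := hc (some s.succ) (some t.succ) (by simpa using hst)
      (a₁ := e.symm p) (a₂ := e.symm p') hpp
    simpa using this

/-- At most `n` MOLS of order `n ≥ 2`. -/
lemma hasMOLS_le {n r : ℕ} (hn : 2 ≤ n) (h : HasMOLS n r) : r ≤ n := by
  obtain ⟨L, hL, ho⟩ := h
  let z : Fin n := ⟨0, by omega⟩
  let o : Fin n := ⟨1, by omega⟩
  have hs : ∀ s, ∃ j, L s o j = L s z z := fun s => ((hL s).1 o).2 _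
  choose f hf using hs
  have hinj : Function.Injective f := by
    intro s t hst
    by_contra hne
    have h1 := ho s t hne (a₁ := (o, f s)) (a₂ := (z, z))
      (Prod.ext (hf s) (by simpa [hst] using hf t))
    have h2 := congrArg (fun p => (Prod.fst p).val) h1
    simp [o, z] at h2
  simpa using Fintype.card_le_of_injective f hinj

section
variable {K : Type} [Field K]

/-- The `TD(17,16)`: level of block `(u,v)` in group `g`. -/
def lev (g : Option K) (w : K × K) : K :=
  match g with
  | none => w.1
  | some x => w.1 * x + w.2

/-- A complementary coordinate. -/
def colev (g : Option K) (w : K × K) : K :=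
  match g with
  | none => w.2
  | some _ => w.1

lemma lev_colev {g : Option K} {w w' : K × K} (h : lev g w = lev g w')
    (h' : colev g w = colev g w') : w = w' := by
  obtain ⟨u, v⟩ := w
  obtain ⟨u', v'⟩ := w'
  cases g <;> simp_all [lev, colev]

lemma affine_inj {F : Type} [Field F] {x y a b a' b' : F} (hxy : x ≠ y)
    (h : a * x + b = a' * x + b') (h' : a * y + b = a' * y + b') : a = a' ∧ b = b' := by
  have h1 : (a - a') * (x - y) = 0 := by linear_combination h - h'
  have h2 : a = a' := by
    rcases mul_eq_zero.1 h1 with h | h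
    · exact sub_eq_zero.1 h
    · exact absurd (sub_eq_zero.1 h) hxy
  subst h2
  exact ⟨rfl, by simpa using h⟩

lemma lev_inj {g h : Option K} (hgh : g ≠ h) {w w' : K × K} (h1 : lev g w = lev g w')
    (h2 : lev h w = lev h w') : w = w' := by
  obtain ⟨u, v⟩ := w
  obtain ⟨u', v'⟩ := w'
  rcases g with _ | x <;> rcases h with _ | y
  · exact absurd rfl hgh
  · simp_all [lev]
  · simp_all [lev]
  · have hxy : x ≠ y := fun h => hgh (by rw [h])
    obtain ⟨rfl, rfl⟩ := affine_inj hxy h1 h2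
    rfl

end

/-- Parallel classes of the `TD(17,19)`: sixteen of them are spread, three are left over. -/
abbrev A := Fin 16 ⊕ Fin 3
/-- Blocks of the `TD(17,16)`: three sets of 15, and 211 others. -/
abbrev U := (Fin 3 × Fin 15) ⊕ Fin 211
/-- Blocks of the final design. -/
abbrev X := A × ZMod 19 × U × ZMod 31 × ZMod 31
/-- Labels of the final parallel classes. -/
abbrev Z := (Fin 3 × ZMod 31 × ZMod 31) ⊕ (Fin 211 × ZMod 31)

/-- Shift in the second factor. -/
def shift16 {K : Type} [Field K] (s : Fin 16 ≃ K) : A → K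
  | Sum.inl i => s i
  | Sum.inr _ => 0

/-- Shift in the third factor. -/
def shift31 {K : Type} [Field K] (e : U ≃ K × K) (r : Fin 15 ⊕ K ≃ ZMod 31) (g : Option K) :
    A → U → ZMod 31
  | Sum.inl _, Sum.inl tq => r (Sum.inl tq.2)
  | Sum.inl _, Sum.inr _ => 0
  | Sum.inr _, w => r (Sum.inr (colev g (e w)))

/-- The final parallel class of a block. -/
def lab : X → Z
  | (Sum.inl _, _, Sum.inl tq, p, q) => Sum.inl (tq.1, p, q)
  | (Sum.inl _, _, Sum.inr m, p, _) => Sum.inr (m, p)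
  | (Sum.inr t, _, _, p, q) => Sum.inl (t, p, q)

/-- The point of the final design on a block in group `(g19, g16, g31)`. -/
def pt {K : Type} [Field K] (α : A ≃ ZMod 19) (s : Fin 16 ≃ K) (e : U ≃ K × K)
    (r : Fin 15 ⊕ K ≃ ZMod 31) (x : ZMod 19) (g : Option K) (y : ZMod 31) (b : X) :
    ZMod 19 × K × ZMod 31 :=
  (α b.1 * x + b.2.1, lev g (e b.2.2.1) + shift16 s b.1,
    b.2.2.2.1 * y + b.2.2.2.2 + shift31 e r g b.1 b.2.2.1)

instance : Fact (Nat.Prime 19) := ⟨by norm_num⟩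
instance : Fact (Nat.Prime 31) := ⟨by norm_num⟩

section
variable {K : Type} [Field K] (α : A ≃ ZMod 19) (s : Fin 16 ≃ K) (e : U ≃ K × K)
    (r : Fin 15 ⊕ K ≃ ZMod 31)

lemma pt_pt {x x' : ZMod 19} {g g' : Option K} {y y' : ZMod 31} (hx : x ≠ x') (hg : g ≠ g')
    (hy : y ≠ y') {b b' : X} (h : pt α s e r x g y b = pt α s e r x g y b')
    (h' : pt α s e r x' g' y' b = pt α s e r x' g' y' b') : b = b' := by
  obtain ⟨a, d, w, p, q⟩ := b
  obtain ⟨a', d', w', p', q'⟩ := b'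
  simp only [pt, Prod.mk.injEq] at h h'
  obtain ⟨h1, h2, h3⟩ := h
  obtain ⟨h1', h2', h3'⟩ := h'
  obtain ⟨ha, rfl⟩ := affine_inj hx h1 h1'
  obtain rfl := α.injective ha
  obtain rfl := e.injective (lev_inj hg (add_right_cancel h2) (add_right_cancel h2'))
  obtain ⟨rfl, rfl⟩ := affine_inj hy (add_right_cancel h3) (add_right_cancel h3')
  rfl

lemma pt_lab {x : ZMod 19} {g : Option K} {y : ZMod 31}
    {b b' : X} (h : pt α s e r x g y b = pt α s e r x g y b')
    (h' : lab b = lab b') : b = b' := by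
  obtain ⟨a, d, w, p, q⟩ := b
  obtain ⟨a', d', w', p', q'⟩ := b'
  simp only [pt, Prod.mk.injEq] at h
  obtain ⟨h1, h2, h3⟩ := h
  rcases a with i | t <;> rcases a' with i' | t'
  · rcases w with ⟨t, k⟩ | m <;> rcases w' with ⟨t', k'⟩ | m'
    · simp only [lab, Sum.inl.injEq, Prod.mk.injEq] at h'
      obtain ⟨rfl, rfl, rfl⟩ := h'
      have hk : k = k' := by
        have := r.injective (add_left_cancel h3)
        simpa using this
      subst hk
      have hi : i = i' := s.injective (add_left_cancel h2)
      subst hi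
      rw [add_left_cancel h1]
    · simp [lab] at h'
    · simp [lab] at h'
    · simp only [lab, Sum.inr.injEq, Prod.mk.injEq] at h'
      obtain ⟨rfl, rfl⟩ := h'
      have hi : i = i' := s.injective (add_left_cancel h2)
      subst hi
      rw [add_left_cancel h1, add_left_cancel (add_right_cancel h3)]
  · rcases w with ⟨t, k⟩ | m
    · simp only [lab, Sum.inl.injEq, Prod.mk.injEq] at h'
      obtain ⟨rfl, rfl, rfl⟩ := h'
      have := r.injective (add_left_cancel h3)
      simp at this
    · simp [lab] at h'
  · rcases w' with ⟨t', k⟩ | m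
    · simp only [lab, Sum.inl.injEq, Prod.mk.injEq] at h'
      obtain ⟨rfl, rfl, rfl⟩ := h'
      have := r.injective (add_left_cancel h3)
      simp at this
    · simp [lab] at h'
  · simp only [lab, Sum.inl.injEq, Prod.mk.injEq] at h'
    obtain ⟨rfl, rfl, rfl⟩ := h'
    have hc : colev g (e w) = colev g (e w') := by
      have := r.injective (add_left_cancel h3)
      simpa using this
    obtain rfl := e.injective (lev_colev (add_right_cancel h2) hc)
    rw [add_left_cancel h1]

end

lemma hasMOLS_main : HasMOLS (16 * 19 * 31) 16 := by
  classical
  obtain ⟨K, hF, hFin, hK⟩ : ∃ (K : Type) (_ : Field K) (_ : Fintype K), Fintype.card K = 16 := by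
    haveI : Fact (Nat.Prime 2) := ⟨Nat.prime_two⟩
    haveI : Fintype (GaloisField 2 4) := Fintype.ofFinite _
    refine ⟨GaloisField 2 4, inferInstance, inferInstance, ?_⟩
    rw [← Nat.card_eq_fintype_card, GaloisField.card 2 4 (by norm_num)]
    norm_num
  have α : A ≃ ZMod 19 := Fintype.equivOfCardEq (by simp [ZMod.card])
  have s : Fin 16 ≃ K := Fintype.equivOfCardEq (by simp [hK])
  have e : U ≃ K × K := Fintype.equivOfCardEq (by simp [hK])
  have r : Fin 15 ⊕ K ≃ ZMod 31 := Fintype.equivOfCardEq (by simp [hK, ZMod.card])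
  have γ : Fin 17 ≃ Option K := Fintype.equivOfCardEq (by simp [hK])
  have P : ZMod 19 × K × ZMod 31 ≃ Fin (16 * 19 * 31) :=
    Fintype.equivOfCardEq (by simp [hK, ZMod.card])
  have Q : Z ≃ Fin (16 * 19 * 31) := Fintype.equivOfCardEq (by simp [ZMod.card])
  have hx : ∀ g h : Fin 17, g ≠ h → ((g.val : ℕ) : ZMod 19) ≠ ((h.val : ℕ) : ZMod 19) := by
    intro g h hgh hc
    rw [ZMod.natCast_eq_natCast_iff'] at hc
    apply hgh
    ext
    omega
  have hy : ∀ g h : Fin 17, g ≠ h → ((g.val : ℕ) : ZMod 31) ≠ ((h.val : ℕ) : ZMod 31) := by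
    intro g h hgh hc
    rw [ZMod.natCast_eq_natCast_iff'] at hc
    apply hgh
    ext
    omega
  let c : Option (Fin 17) → X → Fin (16 * 19 * 31) := fun o b =>
    match o with
    | none => Q (lab b)
    | some g => P (pt α s e r (g.val : ZMod 19) (γ g) (g.val : ZMod 31) b)
  refine hasMOLS_of_array (X := X) (by simp [ZMod.card]) c ?_
  intro g h hgh b b' hbb
  have h1 : c g b = c g b' := congrArg Prod.fst hbb
  have h2 : c h b = c h b' := congrArg Prod.snd hbb
  rcases g with _ | g <;> rcases h with _ | h
  · exact absurd rfl hgh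
  · exact pt_lab α s e r (P.injective h2) (Q.injective h1)
  · exact pt_lab α s e r (P.injective h1) (Q.injective h2)
  · have hne : g ≠ h := fun h => hgh (by rw [h])
    exact pt_pt α s e r (hx g h hne) (γ.injective.ne hne) (hy g h hne)
      (P.injective h1) (P.injective h2)

end TripleProduct

theorem molsNum_9424 : 16 ≤ molsNum (16 * 19 * 31) := by
  refine le_csSup ⟨16 * 19 * 31, ?_⟩ TripleProduct.hasMOLS_main
  intro r hr
  exact TripleProduct.hasMOLS_le (by norm_num) hr
end

section
/- N(9367) ≥ 17; that is, there exist 17 mutually orthogonal latin squares of order 9367 = 17 × 19 × 29. -/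
namespace TripleProduct

instance : Fact (Nat.Prime 17) := ⟨by norm_num⟩
instance : Fact (Nat.Prime 29) := ⟨by norm_num⟩

lemma hasMOLS_of_columns {n r : ℕ} {B : Type} [Fintype B] (hB : Fintype.card B = n * n)
    (F : Fin (r + 2) → B → Fin n)
    (hF : ∀ i j, i ≠ j → Function.Injective fun b => (F i b, F j b)) : HasMOLS n r := by
  have h01 : (0 : Fin (r + 2)) ≠ 1 := by simp
  have hbij : Function.Bijective fun b => (F 0 b, F 1 b) := by
    rw [Fintype.bijective_iff_injective_and_card]
    exact ⟨hF 0 1 h01, by simp [hB]⟩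
  let e : B ≃ Fin n × Fin n := Equiv.ofBijective _ hbij
  have he0 : ∀ p, F 0 (e.symm p) = p.1 := fun p => congrArg Prod.fst (e.apply_symm_apply p)
  have he1 : ∀ p, F 1 (e.symm p) = p.2 := fun p => congrArg Prod.snd (e.apply_symm_apply p)
  have hs0 : ∀ s : Fin r, (0 : Fin (r + 2)) ≠ s.succ.succ := fun s => (Fin.succ_ne_zero _).symm
  have hs1 : ∀ s : Fin r, (1 : Fin (r + 2)) ≠ s.succ.succ := fun s h => by
    have := congrArg Fin.val h
    simp at this
  refine ⟨fun s i j => F s.succ.succ (e.symm (i, j)), fun s => ⟨fun i => ?_, fun j => ?_⟩, ?_⟩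
  · refine Finite.injective_iff_bijective.1 fun j j' h => ?_
    have := hF _ _ (hs0 s) (a₁ := e.symm (i, j)) (a₂ := e.symm (i, j'))
      (Prod.ext (by simp [he0]) h)
    simpa using this
  · refine Finite.injective_iff_bijective.1 fun i i' h => ?_
    have := hF _ _ (hs1 s) (a₁ := e.symm (i, j)) (a₂ := e.symm (i', j))
      (Prod.ext (by simp [he1]) h)
    simpa using this
  · intro s t hst p q h
    exact e.symm.injective (hF s.succ.succ t.succ.succ (by simpa using hst) h)

/-- Blocks of the triple product: `((a, b), (c, d), (e, g))`. -/
abbrev Blk := (ZMod 19 × ZMod 19) × (ZMod 17 × ZMod 17) × (ZMod 29 × ZMod 29)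

/-- Parallel classes of the first product that are merged with a 17-parallel class. -/
def Special (p : ZMod 17 × ZMod 17) : Prop := p.2.val < 2 ∧ p.1.val < 12

instance : DecidablePred Special := fun p => by unfold Special; infer_instance

/-- Labels of the parallel classes. -/
abbrev Lab := (Bool × ZMod 29 × ZMod 29) ⊕ ({p : ZMod 17 × ZMod 17 // ¬ Special p} × ZMod 29)

abbrev Pt := ZMod 19 × ZMod 17 × ZMod 29

/-- The columns of the TD(18,17). -/
def hcol (i : Fin 18) (p : ZMod 17 × ZMod 17) : ZMod 17 :=
  if i.val = 17 then p.1 else p.1 * (i.val : ZMod 17) + p.2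

/-- Colour, below 29, used for the second product. -/
def colour (i : Fin 18) (a : ZMod 19) (p : ZMod 17 × ZMod 17) : ℕ :=
  if 17 ≤ a.val then (if i.val = 17 then p.2.val else p.1.val)
  else if Special p then 17 + p.1.val else 0

lemma colour_lt (i a p) : colour i a p < 29 := by
  have h1 := p.1.val_lt
  have h2 := p.2.val_lt
  unfold colour
  split_ifs with _ _ h
  · omega
  · omega
  · have := h.2
    omega
  · omega

def point (i : Fin 18) (x : Blk) : Pt :=
  (x.1.1 * (i.val : ZMod 19) + x.1.2, hcol i x.2.1 + (x.1.1.val : ZMod 17),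
    x.2.2.1 * (i.val : ZMod 29) + x.2.2.2 + (colour i x.1.1 x.2.1 : ZMod 29))

def label (x : Blk) : Lab :=
  if 17 ≤ x.1.1.val then Sum.inl (decide (x.1.1.val = 18), x.2.2)
  else if h : Special x.2.1 then Sum.inl (decide (x.2.1.2.val = 1), x.2.2)
  else Sum.inr (⟨x.2.1, h⟩, x.2.2.1)

lemma card_blk : Fintype.card Blk = (17 * 19 * 29) * (17 * 19 * 29) := by
  simp [ZMod.card]

lemma card_pt : Fintype.card Pt = 17 * 19 * 29 := by
  simp [ZMod.card]

lemma card_nonspecial : Fintype.card {p : ZMod 17 × ZMod 17 // ¬ Special p} = 265 := by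
  decide +kernel

lemma card_lab : Fintype.card Lab = 17 * 19 * 29 := by
  rw [Fintype.card_sum, Fintype.card_prod, Fintype.card_prod, Fintype.card_prod, card_nonspecial]
  simp [ZMod.card]

lemma cast_eq {p m n : ℕ} (hm : m < p) (hn : n < p) (h : (m : ZMod p) = n) : m = n := by
  rw [ZMod.natCast_eq_natCast_iff] at h
  exact Nat.ModEq.eq_of_lt_of_lt h hm hn

lemma line_inj {p : ℕ} [Fact p.Prime] {m n : ℕ} (hm : m < p) (hn : n < p) (hmn : m ≠ n)
    {a b a' b' : ZMod p} (h1 : a * m + b = a' * m + b') (h2 : a * n + b = a' * n + b') :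
    a = a' ∧ b = b' := by
  have h3 : (a - a') * ((m : ZMod p) - n) = 0 := by linear_combination h1 - h2
  have h4 : (m : ZMod p) - n ≠ 0 := fun h => hmn (cast_eq hm hn (sub_eq_zero.1 h))
  have h5 : a = a' := sub_eq_zero.1 ((mul_eq_zero.1 h3).resolve_right h4)
  subst h5
  exact ⟨rfl, add_left_cancel h1⟩

lemma hcol_inj {i j : Fin 18} (hij : i ≠ j) {p q : ZMod 17 × ZMod 17}
    (h1 : hcol i p = hcol i q) (h2 : hcol j p = hcol j q) : p = q := by
  have hi := i.isLt
  have hj := j.isLt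
  have hne : i.val ≠ j.val := fun h => hij (Fin.ext h)
  obtain ⟨c, d⟩ := p
  obtain ⟨c', d'⟩ := q
  unfold hcol at h1 h2
  simp only at h1 h2
  split_ifs at h1 h2 with hi' hj' hj'
  · omega
  · subst h1
    rw [add_left_cancel h2]
  · subst h2
    rw [add_left_cancel h1]
  · obtain ⟨h, h'⟩ := line_inj (by omega) (by omega) hne h1 h2
    rw [h, h']

lemma point_inj {i j : Fin 18} (hij : i ≠ j) :
    Function.Injective fun x => (point i x, point j x) := by
  have hi := i.isLt
  have hj := j.isLt
  have hne : i.val ≠ j.val := fun h => hij (Fin.ext h)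
  rintro ⟨⟨a, b⟩, p, ⟨e, g⟩⟩ ⟨⟨a', b'⟩, p', ⟨e', g'⟩⟩ h
  simp only [point, Prod.mk.injEq] at h
  obtain ⟨⟨h1, h2, h3⟩, k1, k2, k3⟩ := h
  obtain ⟨rfl, rfl⟩ := line_inj (by omega) (by omega) hne h1 k1
  obtain rfl := hcol_inj hij (add_right_cancel h2) (add_right_cancel k2)
  obtain ⟨rfl, rfl⟩ := line_inj (by omega) (by omega) hne (add_right_cancel h3)
    (add_right_cancel k3)
  rfl

lemma label_inj (i : Fin 18) : Function.Injective fun x => (point i x, label x) := by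
  rintro ⟨⟨a, b⟩, ⟨c, d⟩, ⟨e, g⟩⟩ ⟨⟨a', b'⟩, ⟨c', d'⟩, ⟨e', g'⟩⟩ h
  simp only [point, Prod.mk.injEq] at h
  obtain ⟨⟨h1, h2, h3⟩, hl⟩ := h
  have ha := a.val_lt
  have ha' := a'.val_lt
  have hc := c.val_lt
  have hc' := c'.val_lt
  have hd := d.val_lt
  have hd' := d'.val_lt
  have hcol_eq : e = e' → g = g' → colour i a (c, d) = colour i a' (c', d') := by
    rintro rfl rfl
    exact cast_eq (colour_lt _ _ _) (colour_lt _ _ _) (add_left_cancel h3)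
  by_cases A : 17 ≤ a.val <;> by_cases A' : 17 ≤ a'.val
  · simp only [label, A, A', if_true, Sum.inl.injEq, Prod.mk.injEq, decide_eq_decide] at hl
    obtain ⟨l1, rfl, rfl⟩ := hl
    have hcc := hcol_eq rfl rfl
    obtain rfl : a = a' := ZMod.val_injective 19 (by omega)
    obtain rfl := add_left_cancel h1
    replace h2 := add_right_cancel h2
    simp only [colour, A, if_true] at hcc
    simp only [hcol] at h2
    split_ifs at hcc h2
    · obtain rfl := ZMod.val_injective 17 hcc
      subst h2
      rfl
    · obtain rfl := ZMod.val_injective 17 hcc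
      rw [add_left_cancel h2]
  · exfalso
    by_cases S : Special (c', d')
    · simp only [label, A, A', S, if_true, if_false, dif_pos, Sum.inl.injEq, Prod.mk.injEq] at hl
      have hcc := hcol_eq hl.2.1 hl.2.2
      simp only [colour, A, A', S, if_true, if_false] at hcc
      split_ifs at hcc <;> omega
    · simp [label, A, A', S] at hl
  · exfalso
    by_cases S : Special (c, d)
    · simp only [label, A, A', S, if_true, if_false, dif_pos, Sum.inl.injEq, Prod.mk.injEq] at hl
      have hcc := hcol_eq hl.2.1 hl.2.2
      simp only [colour, A, A', S, if_true, if_false] at hcc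
      split_ifs at hcc <;> omega
    · simp [label, A, A', S] at hl
  · have key : c = c' → d = d' → a = a' ∧ b = b' := by
      rintro rfl rfl
      obtain rfl : a = a' :=
        ZMod.val_injective 19 (cast_eq (by omega) (by omega) (add_left_cancel h2))
      exact ⟨rfl, add_left_cancel h1⟩
    by_cases S : Special (c, d) <;> by_cases S' : Special (c', d')
    · simp only [label, A, A', S, S', if_false, dif_pos, Sum.inl.injEq, Prod.mk.injEq,
        decide_eq_decide] at hl
      obtain ⟨l1, rfl, rfl⟩ := hl
      have hcc := hcol_eq rfl rfl
      simp only [colour, A, A', S, S', if_true, if_false] at hcc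
      simp only [Special] at S S'
      obtain rfl : c = c' := ZMod.val_injective 17 (by omega)
      obtain rfl : d = d' := ZMod.val_injective 17 (by omega)
      obtain ⟨rfl, rfl⟩ := key rfl rfl
      rfl
    · simp [label, A, A', S, S'] at hl
    · simp [label, A, A', S, S'] at hl
    · simp only [label, A, A', S, S', if_false, dif_neg, not_false_eq_true, Sum.inr.injEq,
        Prod.mk.injEq, Subtype.mk.injEq] at hl
      obtain ⟨⟨rfl, rfl⟩, rfl⟩ := hl
      obtain ⟨rfl, rfl⟩ := key rfl rfl
      rw [add_left_cancel (add_right_cancel h3)]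

theorem hasMOLS : HasMOLS (17 * 19 * 29) 17 := by
  let eP : Pt ≃ Fin (17 * 19 * 29) := Fintype.equivFinOfCardEq card_pt
  let eL : Lab ≃ Fin (17 * 19 * 29) := Fintype.equivFinOfCardEq card_lab
  let F : Fin (17 + 2) → Blk → Fin (17 * 19 * 29) := fun i x =>
    if h : i.val < 18 then eP (point ⟨i.val, h⟩ x) else eL (label x)
  refine hasMOLS_of_columns card_blk F fun i j hij x y h => ?_
  have hne : i.val ≠ j.val := fun h => hij (Fin.ext h)
  have hi := i.isLt
  have hj := j.isLt
  obtain ⟨h1, h2⟩ := Prod.mk.inj h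
  simp only [F] at h1 h2
  split_ifs at h1 h2 with hi' hj' hj'
  · exact point_inj (i := ⟨i.val, hi'⟩) (j := ⟨j.val, hj'⟩) (by simpa using hne)
      (Prod.ext (eP.injective h1) (eP.injective h2))
  · exact label_inj ⟨i.val, hi'⟩ (Prod.ext (eP.injective h1) (eL.injective h2))
  · exact label_inj ⟨j.val, hj'⟩ (Prod.ext (eP.injective h2) (eL.injective h1))
  · omega

end TripleProduct

theorem molsNum_9367 : 17 ≤ molsNum (17 * 19 * 29) := by
  refine le_csSup ⟨17 * 19 * 29, fun r hr => ?_⟩ TripleProduct.hasMOLS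
  exact TripleProduct.hasMOLS_le (by norm_num) hr
end
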